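/- arXiv:2605.30439 — 2 statements merged into one kernel-verified Lean document; each statement's English description precedes it below -/
import Mathlib

section
/- Let R be a commutative ring and q ∈ R. Let M₊(q) be the 6×6 matrix over R with rows (0, 4q, 0, 0, 32q², 0), (1, 0, 6q, 2q, 0, 16q²), (0, 1, 0, 0, 6q, 0), (0, 2, 0, 0, 4q, 0), (0, 0, 1, 1, 0, 2q), (0, 0, 0, 0, 2, 0), and let M₋(q) be the 3×3 matrix with rows (0, 2q, 0), (1, 0, 2q), (0, 1, 0). Then the characteristic polynomial of the 9×9 block-diagonal matrix 2·M₊(q) ⊕ 2·M₋(q) equals X³·(X² − 16q)·(X² − 128q)·(X² + 16q) in R[X]. -/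
open Polynomial

def Mplus (R : Type*) [CommRing R] (q : R) : Matrix (Fin 6) (Fin 6) R :=
  !![0, 4*q, 0, 0, 32*q^2, 0;
     1, 0, 6*q, 2*q, 0, 16*q^2;
     0, 1, 0, 0, 6*q, 0;
     0, 2, 0, 0, 4*q, 0;
     0, 0, 1, 1, 0, 2*q;
     0, 0, 0, 0, 2, 0]

def Mminus (R : Type*) [CommRing R] (q : R) : Matrix (Fin 3) (Fin 3) R :=
  !![0, 2*q, 0;
     1, 0, 2*q;
     0, 1, 0]

theorem C_lit_2 (R : Type*) [CommRing R] : (C (2 : R) : R[X]) = 2 := map_ofNat C 2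

theorem C_lit_4 (R : Type*) [CommRing R] : (C (4 : R) : R[X]) = 4 := map_ofNat C 4

theorem C_lit_6 (R : Type*) [CommRing R] : (C (6 : R) : R[X]) = 6 := map_ofNat C 6

theorem C_lit_16 (R : Type*) [CommRing R] : (C (16 : R) : R[X]) = 16 := map_ofNat C 16

theorem C_lit_32 (R : Type*) [CommRing R] : (C (32 : R) : R[X]) = 32 := map_ofNat C 32

theorem C_lit_128 (R : Type*) [CommRing R] : (C (128 : R) : R[X]) = 128 := map_ofNat C 128

theorem Mplus_charpoly (R : Type*) [CommRing R] (q : R) :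
    ((2 : R) • Mplus R q).charpoly = X ^ 2 * (X ^ 2 - C (128 * q)) * (X ^ 2 + C (16 * q)) := by
  have h : ((2 : R) • Mplus R q).charmatrix =
      !![X, -(8 * C q), 0, 0, -(64 * C q ^ 2), 0;
         -2, X, -(12 * C q), -(4 * C q), 0, -(32 * C q ^ 2);
         0, -2, X, 0, -(12 * C q), 0;
         0, -4, 0, X, -(8 * C q), 0;
         0, 0, -2, -2, X, -(4 * C q);
         0, 0, 0, 0, -4, X] := by
    ext1 i j
    fin_cases i <;> fin_cases j <;>
      simp [C_lit_2, C_lit_4, C_lit_6, C_lit_16, C_lit_32, C_lit_128, Mplus] <;> try ring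
  rw [Matrix.charpoly, h]
  simp [C_lit_2, C_lit_4, C_lit_6, C_lit_16, C_lit_32, C_lit_128, Matrix.det_succ_row_zero, Fin.sum_univ_succ, Fin.succAbove]
  ring

theorem Mminus_charpoly (R : Type*) [CommRing R] (q : R) :
    ((2 : R) • Mminus R q).charpoly = X * (X ^ 2 - C (16 * q)) := by
  have h : ((2 : R) • Mminus R q).charmatrix =
      !![X, -(4 * C q), 0; -2, X, -(4 * C q); 0, -2, X] := by
    ext1 i j
    fin_cases i <;> fin_cases j <;>
      simp [C_lit_2, C_lit_4, C_lit_6, C_lit_16, C_lit_32, C_lit_128, Mminus] <;> try ring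
  rw [Matrix.charpoly, h, Matrix.det_fin_three]
  simp [C_lit_2, C_lit_4, C_lit_6, C_lit_16, C_lit_32, C_lit_128]
  ring

theorem charpoly_block_diag (R : Type*) [CommRing R] (q : R) :
    (Matrix.fromBlocks ((2 : R) • Mplus R q) 0 0 ((2 : R) • Mminus R q)).charpoly
      = X ^ 3 * (X ^ 2 - C (16 * q)) * (X ^ 2 - C (128 * q)) * (X ^ 2 + C (16 * q)) := by
  rw [Matrix.charpoly_fromBlocks_zero₁₂, Mplus_charpoly, Mminus_charpoly]
  ring
end

section
/- Let f₀ ∈ ℚ[x₀, x₁, x₂, y₀, y₁, y₂] be the bidegree-(2,2) polynomial f₀ = Σ_{i,j=1}^{6} A_{ij} Q_{x,i} Q_{y,j}, where Qₓ = (x₀², x₀x₁, x₀x₂, x₁², x₁x₂, x₂²), Q_y = (y₀², y₀y₁, y₀y₂, y₁², y₁y₂, y₂²), and A is the symmetric 6×6 integer matrix with rows (1,1,−2,0,2,1), (1,1,0,1,0,2), (−2,0,−1,2,−1,0), (0,1,2,−1,−2,2), (2,0,−1,−2,0,2), (1,2,0,2,2,2). Let S₍₂,₂₎⁺ be the 21-dimensional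 ℚ-vector space of bihomogeneous bidegree-(2,2) polynomials fixed by the involution swapping xᵢ ↔ yᵢ, and for 0 ≤ i, j ≤ 2 let g_{ij} = x_j·(∂f₀/∂xᵢ) + y_j·(∂f₀/∂yᵢ). Then each g_{ij} lies in S₍₂,₂₎⁺, and the quotient of S₍₂,₂₎⁺ by the span of the nine polynomials g_{ij} has dimension 12. -/
open MvPolynomial

noncomputable section

/-- The variable `xᵢ`. -/
def xv (i : Fin 3) : MvPolynomial (Fin 3 ⊕ Fin 3) ℚ := X (Sum.inl i)

/-- The variable `yᵢ`. -/
def yv (i : Fin 3) : MvPolynomial (Fin 3 ⊕ Fin 3) ℚ := X (Sum.inr i)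

/-- The quadratic monomials in the `x` variables. -/
def Qx : Fin 6 → MvPolynomial (Fin 3 ⊕ Fin 3) ℚ :=
  ![xv 0 ^ 2, xv 0 * xv 1, xv 0 * xv 2, xv 1 ^ 2, xv 1 * xv 2, xv 2 ^ 2]

/-- The quadratic monomials in the `y` variables. -/
def Qy : Fin 6 → MvPolynomial (Fin 3 ⊕ Fin 3) ℚ :=
  ![yv 0 ^ 2, yv 0 * yv 1, yv 0 * yv 2, yv 1 ^ 2, yv 1 * yv 2, yv 2 ^ 2]

/-- The coefficient matrix. -/
def A : Matrix (Fin 6) (Fin 6) ℚ :=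
  !![ 1,  1, -2,  0,  2,  1;
      1,  1,  0,  1,  0,  2;
     -2,  0, -1,  2, -1,  0;
      0,  1,  2, -1, -2,  2;
      2,  0, -1, -2,  0,  2;
      1,  2,  0,  2,  2,  2]

/-- The symmetric branch polynomial `f₀`. -/
def f0 : MvPolynomial (Fin 3 ⊕ Fin 3) ℚ :=
  ∑ i : Fin 6, ∑ j : Fin 6, C (A i j) * Qx i * Qy j


/-- The invariant infinitesimal diagonal `GL₃`-orbit generators. -/
def g (i j : Fin 3) : MvPolynomial (Fin 3 ⊕ Fin 3) ℚ :=
  xv j * pderiv (Sum.inl i) f0 + yv j * pderiv (Sum.inr i) f0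

/-- The space of bihomogeneous polynomials of bidegree (2,2). -/
def S22 : Submodule ℚ (MvPolynomial (Fin 3 ⊕ Fin 3) ℚ) :=
  restrictSupport ℚ
    {d : (Fin 3 ⊕ Fin 3) →₀ ℕ |
      (∑ i : Fin 3, d (Sum.inl i)) = 2 ∧ (∑ i : Fin 3, d (Sum.inr i)) = 2}

/-- The linear involution induced by swapping `xᵢ ↔ yᵢ`. -/
def swapMap : MvPolynomial (Fin 3 ⊕ Fin 3) ℚ →ₗ[ℚ] MvPolynomial (Fin 3 ⊕ Fin 3) ℚ :=
  (rename (Equiv.sumComm (Fin 3) (Fin 3))).toLinearMap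

/-- The symmetric bidegree-(2,2) polynomials `S₍₂,₂₎⁺`. -/
def S22plus : Submodule ℚ (MvPolynomial (Fin 3 ⊕ Fin 3) ℚ) :=
  S22 ⊓ LinearMap.ker (swapMap - LinearMap.id)

lemma quartic_mem (a b c d : Fin 3) : xv a * xv b * (yv c * yv d) ∈ S22 := by
  have : xv a * xv b * (yv c * yv d) = monomial (Finsupp.single (Sum.inl a) 1 +
      Finsupp.single (Sum.inl b) 1 + (Finsupp.single (Sum.inr c) 1 +
      Finsupp.single (Sum.inr d) 1)) (1 : ℚ) := by
    simp only [xv, yv, X, monomial_mul, mul_one]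
  rw [this, S22, monomial_mem_restrictSupport]
  left
  simp only [Set.mem_setOf_eq, Finsupp.add_apply, Finset.sum_add_distrib, Finsupp.single_apply]
  constructor <;> simp

lemma f0_mem : f0 ∈ S22 := by
  unfold f0
  refine Submodule.sum_mem _ fun i _ => Submodule.sum_mem _ fun j _ => ?_
  rw [mul_assoc, ← smul_eq_C_mul]
  apply Submodule.smul_mem
  have hx : ∃ a b, Qx i = xv a * xv b := by
    fin_cases i
    exacts [⟨0, 0, sq _⟩, ⟨0, 1, rfl⟩, ⟨0, 2, rfl⟩, ⟨1, 1, sq _⟩, ⟨1, 2, rfl⟩, ⟨2, 2, sq _⟩]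
  have hy : ∃ a b, Qy j = yv a * yv b := by
    fin_cases j
    exacts [⟨0, 0, sq _⟩, ⟨0, 1, rfl⟩, ⟨0, 2, rfl⟩, ⟨1, 1, sq _⟩, ⟨1, 2, rfl⟩, ⟨2, 2, sq _⟩]
  obtain ⟨a, b, hx⟩ := hx
  obtain ⟨c, d, hy⟩ := hy
  rw [hx, hy]
  exact quartic_mem a b c d

lemma sum_shift (u : Fin 3 → ℕ) (i j : Fin 3) (h : u i ≠ 0) :
    ∑ k, ((u k - if i = k then 1 else 0) + if j = k then 1 else 0) = ∑ k, u k := by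
  fin_cases i <;> fin_cases j <;> simp [Fin.sum_univ_three] at * <;> omega

lemma shift_x_mem (i j : Fin 3) (p) (hp : p ∈ S22) :
    xv j * pderiv (Sum.inl i) p ∈ S22 := by
  rw [S22, restrictSupport_eq_span] at hp
  induction hp using Submodule.span_induction with
  | mem x h =>
    obtain ⟨s, ⟨h1, h2⟩, rfl⟩ := h
    simp only [pderiv_monomial, xv, X, monomial_mul, S22, monomial_mem_restrictSupport]
    by_cases hs : s (Sum.inl i) = 0
    · right; simp [hs]
    · left
      rw [add_comm]
      constructor
      · rw [← h1, ← sum_shift (fun k => s (Sum.inl k)) i j hs]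
        simp [Finsupp.single_apply]
      · rw [← h2]
        simp [Finsupp.single_apply]
  | zero => simp
  | add x y _ _ hx hy => rw [map_add, mul_add]; exact Submodule.add_mem _ hx hy
  | smul a x _ hx => rw [Derivation.map_smul, mul_smul_comm]; exact Submodule.smul_mem _ _ hx

lemma shift_y_mem (i j : Fin 3) (p) (hp : p ∈ S22) :
    yv j * pderiv (Sum.inr i) p ∈ S22 := by
  rw [S22, restrictSupport_eq_span] at hp
  induction hp using Submodule.span_induction with
  | mem x h =>
    obtain ⟨s, ⟨h1, h2⟩, rfl⟩ := h
    simp only [pderiv_monomial, yv, X, monomial_mul, S22, monomial_mem_restrictSupport]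
    by_cases hs : s (Sum.inr i) = 0
    · right; simp [hs]
    · left
      rw [add_comm]
      constructor
      · rw [← h1]
        simp [Finsupp.single_apply]
      · rw [← h2, ← sum_shift (fun k => s (Sum.inr k)) i j hs]
        simp [Finsupp.single_apply]
  | zero => simp
  | add x y _ _ hx hy => rw [map_add, mul_add]; exact Submodule.add_mem _ hx hy
  | smul a x _ hx => rw [Derivation.map_smul, mul_smul_comm]; exact Submodule.smul_mem _ _ hx

lemma A_symm (i j : Fin 6) : A i j = A j i := by
  fin_cases i <;> fin_cases j <;> rfl

lemma rename_Qx (i : Fin 6) : rename (Equiv.sumComm (Fin 3) (Fin 3)) (Qx i) = Qy i := by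
  fin_cases i <;> simp [Qx, Qy, xv, yv]

lemma rename_Qy (i : Fin 6) : rename (Equiv.sumComm (Fin 3) (Fin 3)) (Qy i) = Qx i := by
  fin_cases i <;> simp [Qx, Qy, xv, yv]

lemma rename_f0 : rename (Equiv.sumComm (Fin 3) (Fin 3)) f0 = f0 := by
  simp only [f0, map_sum, map_mul, rename_C, rename_Qx, rename_Qy]
  rw [Finset.sum_comm]
  refine Finset.sum_congr rfl fun i _ => Finset.sum_congr rfl fun j _ => ?_
  rw [A_symm]; ring

lemma g_mem (i j : Fin 3) : g i j ∈ S22plus := by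
  refine ⟨Submodule.add_mem _ (shift_x_mem i j _ f0_mem) (shift_y_mem i j _ f0_mem), ?_⟩
  rw [SetLike.mem_coe, LinearMap.mem_ker, LinearMap.sub_apply, sub_eq_zero]
  have h1 := pderiv_rename (Equiv.sumComm (Fin 3) (Fin 3)).injective (Sum.inl i) f0
  have h2 := pderiv_rename (Equiv.sumComm (Fin 3) (Fin 3)).injective (Sum.inr i) f0
  rw [rename_f0] at h1 h2
  simp only [Equiv.sumComm_apply, Sum.swap_inl, Sum.swap_inr] at h1 h2
  simp only [swapMap, g, AlgHom.toLinearMap_apply, map_add, map_mul, LinearMap.id_apply,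
    Equiv.sumComm_apply]
  rw [← h1, ← h2]
  simp only [xv, yv, rename_X, Sum.swap_inl, Sum.swap_inr]
  ring

/-- Exponents of the quadratic monomials in three variables. -/
def expo : Fin 6 → Fin 3 → ℕ :=
  ![![2, 0, 0], ![1, 1, 0], ![1, 0, 1], ![0, 2, 0], ![0, 1, 1], ![0, 0, 2]]

lemma expo_inj : Function.Injective expo := by decide

lemma expo_sum (k : Fin 6) : ∑ i, expo k i = 2 := by
  revert k; decide

lemma exists_expo (u : Fin 3 → ℕ) (h : ∑ i, u i = 2) : ∃ k, u = expo k := by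
  rw [Fin.sum_univ_three] at h
  have key : ∀ a b c : Fin 3, (a : ℕ) + b + c = 2 →
      ∃ k, ![(a : ℕ), (b : ℕ), (c : ℕ)] = expo k := by decide
  obtain ⟨k, hk⟩ := key ⟨u 0, by omega⟩ ⟨u 1, by omega⟩ ⟨u 2, by omega⟩ h
  refine ⟨k, ?_⟩
  rw [← hk]
  ext i
  fin_cases i <;> rfl

/-- Exponent of a monomial of bidegree (2,2). -/
def bexp (k l : Fin 6) : (Fin 3 ⊕ Fin 3) →₀ ℕ :=
  Finsupp.equivFunOnFinite.symm (Sum.elim (expo k) (expo l))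

@[simp] lemma bexp_inl (k l : Fin 6) (i : Fin 3) : bexp k l (Sum.inl i) = expo k i := rfl

@[simp] lemma bexp_inr (k l : Fin 6) (i : Fin 3) : bexp k l (Sum.inr i) = expo l i := rfl

lemma bexp_inj {k l k' l' : Fin 6} : bexp k l = bexp k' l' ↔ k = k' ∧ l = l' := by
  constructor
  · intro h
    constructor
    · apply expo_inj; ext i; simpa using DFunLike.congr_fun h (Sum.inl i)
    · apply expo_inj; ext i; simpa using DFunLike.congr_fun h (Sum.inr i)
  · rintro ⟨rfl, rfl⟩; rfl

lemma exists_bexp (d : (Fin 3 ⊕ Fin 3) →₀ ℕ) (h1 : (∑ i : Fin 3, d (Sum.inl i)) = 2)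
    (h2 : (∑ i : Fin 3, d (Sum.inr i)) = 2) : ∃ k l, d = bexp k l := by
  obtain ⟨k, hk⟩ := exists_expo _ h1
  obtain ⟨l, hl⟩ := exists_expo _ h2
  refine ⟨k, l, ?_⟩
  ext (i | i)
  · exact congrFun hk i
  · exact congrFun hl i

lemma bexp_swap (k l : Fin 6) :
    Finsupp.mapDomain (Equiv.sumComm (Fin 3) (Fin 3)) (bexp k l) = bexp l k := by
  rw [← Finsupp.equivMapDomain_eq_mapDomain]
  ext (i | i) <;> rfl

/-- The symmetric polynomial with given symmetric coefficients. -/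
def symPoly : (Sym2 (Fin 6) → ℚ) →ₗ[ℚ] MvPolynomial (Fin 3 ⊕ Fin 3) ℚ :=
  ∑ k : Fin 6, ∑ l : Fin 6, monomial (bexp k l) ∘ₗ LinearMap.proj s(k, l)

lemma symPoly_apply (c : Sym2 (Fin 6) → ℚ) :
    symPoly c = ∑ k : Fin 6, ∑ l : Fin 6, monomial (bexp k l) (c s(k, l)) := by
  simp [symPoly, LinearMap.sum_apply]

lemma coeff_symPoly (c : Sym2 (Fin 6) → ℚ) (k l : Fin 6) :
    coeff (bexp k l) (symPoly c) = c s(k, l) := by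
  simp only [symPoly_apply, coeff_sum, coeff_monomial, bexp_inj]
  rw [Finset.sum_eq_single k, Finset.sum_eq_single l]
  all_goals simp +contextual

lemma symPoly_mem (c : Sym2 (Fin 6) → ℚ) : symPoly c ∈ S22plus := by
  constructor
  · rw [symPoly_apply]
    refine Submodule.sum_mem _ fun k _ => Submodule.sum_mem _ fun l _ => ?_
    rw [S22, monomial_mem_restrictSupport]
    left
    exact ⟨expo_sum k, expo_sum l⟩
  · rw [SetLike.mem_coe, LinearMap.mem_ker, LinearMap.sub_apply, sub_eq_zero]
    simp only [swapMap, AlgHom.toLinearMap_apply, LinearMap.id_apply, symPoly_apply, map_sum,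
      rename_monomial, bexp_swap]
    rw [Finset.sum_comm]
    refine Finset.sum_congr rfl fun i _ => Finset.sum_congr rfl fun j _ => ?_
    rw [Sym2.eq_swap]

lemma symPoly_surj (p) (hp : p ∈ S22plus) : ∃ c, symPoly c = p := by
  obtain ⟨h1, h2⟩ := hp
  rw [SetLike.mem_coe, LinearMap.mem_ker, LinearMap.sub_apply, sub_eq_zero] at h2
  simp only [swapMap, AlgHom.toLinearMap_apply, LinearMap.id_apply] at h2
  have hs : ∀ k l, coeff (bexp k l) p = coeff (bexp l k) p := by
    intro k l
    conv_lhs => rw [← h2, ← bexp_swap]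
    exact coeff_rename_mapDomain _ (Equiv.sumComm (Fin 3) (Fin 3)).injective _ _
  have hz : ∀ q ∈ S22, ∀ d, (¬ ∃ k l, d = bexp k l) → coeff d q = 0 := by
    intro q hq d hd
    by_contra hne
    have := (mem_restrictSupport_iff ℚ).mp hq (mem_support_iff.mpr hne)
    exact hd (exists_bexp d this.1 this.2)
  refine ⟨Sym2.lift ⟨fun k l => coeff (bexp k l) p, hs⟩, ?_⟩
  ext d
  by_cases hd : ∃ k l, d = bexp k l
  · obtain ⟨k, l, rfl⟩ := hd
    rw [coeff_symPoly]; rfl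
  · rw [hz _ (symPoly_mem _).1 d hd, hz p h1 d hd]

/-- Symmetric forms are parametrized by their coefficients. -/
def symEquiv : (Sym2 (Fin 6) → ℚ) ≃ₗ[ℚ] S22plus :=
  LinearEquiv.ofBijective (symPoly.codRestrict S22plus symPoly_mem) (by
    constructor
    · intro c c' h
      have h' : symPoly c = symPoly c' := congrArg Subtype.val h
      funext s
      induction s using Sym2.ind with
      | _ k l => rw [← coeff_symPoly c k l, h', coeff_symPoly]
    · rintro ⟨p, hp⟩
      obtain ⟨c, hc⟩ := symPoly_surj p hp
      exact ⟨c, Subtype.ext hc⟩)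

lemma finrank_S22plus : Module.finrank ℚ S22plus = 21 := by
  rw [← symEquiv.finrank_eq, Module.finrank_fintype_fun_eq_card, Sym2.card]
  simp [Nat.choose]

lemma f0_eq : f0 = ∑ i : Fin 6, ∑ j : Fin 6, C (A i j) * Qx i * Qy j := rfl

/-- Directional derivatives of the quadratic monomials. -/
def dq (v : Fin 3 → ℚ) (i : Fin 3) : Fin 6 → ℚ :=
  ![2 * v 0 * (if i = 0 then 1 else 0),
    v 0 * (if i = 1 then 1 else 0) + v 1 * (if i = 0 then 1 else 0),
    v 0 * (if i = 2 then 1 else 0) + v 2 * (if i = 0 then 1 else 0),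
    2 * v 1 * (if i = 1 then 1 else 0),
    v 1 * (if i = 2 then 1 else 0) + v 2 * (if i = 1 then 1 else 0),
    2 * v 2 * (if i = 2 then 1 else 0)]

/-- Values of the quadratic monomials. -/
def vq (v : Fin 3 → ℚ) : Fin 6 → ℚ :=
  ![v 0 ^ 2, v 0 * v 1, v 0 * v 2, v 1 ^ 2, v 1 * v 2, v 2 ^ 2]

lemma eval_g (v w : Fin 3 → ℚ) (i j : Fin 3) :
    eval (Sum.elim v w) (g i j) = v j * ∑ k, ∑ l, A k l * dq v i k * vq w l +
      w j * ∑ k, ∑ l, A k l * vq v k * dq w i l := by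
  have hx : ∀ k, eval (Sum.elim v w) (Qx k) = vq v k := by
    intro k; fin_cases k <;> simp [Qx, vq, xv]
  have hy : ∀ k, eval (Sum.elim v w) (Qy k) = vq w k := by
    intro k; fin_cases k <;> simp [Qy, vq, yv]
  have hxx : ∀ k, eval (Sum.elim v w) (pderiv (Sum.inl i) (Qx k)) = dq v i k := by
    intro k; fin_cases k <;> fin_cases i <;>
      simp [Qx, dq, xv, pderiv_X, Pi.single_apply, Derivation.leibniz_pow]
  have hyy : ∀ k, eval (Sum.elim v w) (pderiv (Sum.inr i) (Qy k)) = dq w i k := by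
    intro k; fin_cases k <;> fin_cases i <;>
      simp [Qy, dq, yv, pderiv_X, Pi.single_apply, Derivation.leibniz_pow]
  have hxy : ∀ k, pderiv (Sum.inr i) (Qx k) = 0 := by
    intro k; fin_cases k <;>
      simp [Qx, xv, pderiv_X, Derivation.leibniz_pow]
  have hyx : ∀ k, pderiv (Sum.inl i) (Qy k) = 0 := by
    intro k; fin_cases k <;>
      simp [Qy, yv, pderiv_X, Derivation.leibniz_pow]
  simp only [g, f0_eq, map_add, map_mul, map_sum, Derivation.leibniz, hxy, hyx, pderiv_C,
    smul_eq_mul, mul_zero, zero_add, add_zero, hx, hy, hxx, hyy, eval_C]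
  congr 1
  · simp only [xv, eval_X, Sum.elim_inl]
    congr 1
    refine Finset.sum_congr rfl fun k _ => Finset.sum_congr rfl fun l _ => ?_
    ring
  · simp only [yv, eval_X, Sum.elim_inr]

lemma g_indep : LinearIndependent ℚ (fun p : Fin 3 × Fin 3 => g p.1 p.2) := by
  rw [Fintype.linearIndependent_iff]
  intro c hc
  have key : ∀ v w : Fin 3 → ℚ, ∑ i, ∑ j, c (i, j) *
      (v j * ∑ k, ∑ l, A k l * dq v i k * vq w l +
      w j * ∑ k, ∑ l, A k l * vq v k * dq w i l) = 0 := by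
    intro v w
    have := congrArg (eval (Sum.elim v w)) hc
    rw [Fintype.sum_prod_type] at this
    simpa only [map_sum, smul_eval, eval_g, map_zero] using this
  have h1 := key ![0, 0, 1] ![0, 0, 1]
  have h2 := key ![0, 0, 1] ![0, 1, 0]
  have h3 := key ![0, 0, 1] ![1, 0, 0]
  have h4 := key ![0, 1, 0] ![0, 1, 0]
  have h5 := key ![0, 1, 0] ![1, 0, 0]
  have h6 := key ![1, 0, 0] ![1, 0, 0]
  have h7 := key ![0, 0, 1] ![0, 1, 1]
  have h8 := key ![0, 0, 1] ![1, 0, 1]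
  have h9 := key ![0, 0, 1] ![1, 1, 0]
  simp [Fin.sum_univ_succ, A, dq, vq] at h1 h2 h3 h4 h5 h6 h7 h8 h9
  rintro ⟨i, j⟩
  fin_cases i <;> fin_cases j <;> simp <;> linarith

theorem g_mem_and_quotient_dim :
    (∀ i j : Fin 3, g i j ∈ S22plus) ∧
    Module.finrank ℚ
      (↥S22plus ⧸ Submodule.comap S22plus.subtype
        (Submodule.span ℚ (Set.range fun p : Fin 3 × Fin 3 => g p.1 p.2))) = 12 := by
  refine ⟨g_mem, ?_⟩
  have hfin : Module.Finite ℚ S22plus := Module.Finite.equiv symEquiv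
  have hle : Submodule.span ℚ (Set.range fun p : Fin 3 × Fin 3 => g p.1 p.2) ≤ S22plus := by
    rw [Submodule.span_le]
    rintro _ ⟨p, rfl⟩
    exact g_mem _ _
  have h1 := (Submodule.comapSubtypeEquivOfLe hle).finrank_eq
  rw [finrank_span_eq_card g_indep] at h1
  have h2 := Submodule.finrank_quotient_add_finrank (Submodule.comap S22plus.subtype
    (Submodule.span ℚ (Set.range fun p : Fin 3 × Fin 3 => g p.1 p.2)))
  rw [finrank_S22plus, h1] at h2
  simp at h2
  omega

end
end
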